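/- Let N > 1 be a natural number, let d > 0 and λ > 0 be real with λ ≤ Nd, and let θ₀, θ₁ ∈ [0, 2π). Define for angles α, β, γ and direction θ the effective boresight cosine c(α,β,γ,θ) = −sin α·sin β·cos(γ+θ) + cos α·sin(γ+θ). Then there exist α, β, γ ∈ [0, 2π) such that c(α,β,γ,θ₀) = 1 and at least one of the following holds: (i) ∑_{n=0}^{N-1} exp(i·(2π/λ)·n·d·cos β·(cos(γ+θ₁) − cos(γ+θ₀))) = 0, or (ii) c(α,β,γ,θ₁) ≤ 0, if and only if |θ₀ − θ₁| ∈ [arcsin(λ/(Nd)), 2π − arcsin(λ/(Nd))]. -/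

import Mathlib

open Real Complex Finset

/-- Effective boresight cosine of a rotatable antenna array: cosine of the angle
between the rotated element boresight and the signal direction at θ. -/
noncomputable def ebc (α β γ θ : ℝ) : ℝ :=
  -Real.sin α * Real.sin β * Real.cos (γ + θ) + Real.cos α * Real.sin (γ + θ)

/-- Full gain at `θ₀` aligns the in-plane boresight with `θ₀`. -/
lemma ebc_eq_one_imp {α β γ θ : ℝ} (h : ebc α β γ θ = 1) :
    -(Real.sin α * Real.sin β) = Real.cos (γ + θ) ∧ Real.cos α = Real.sin (γ + θ) ∧
      Real.sin α * Real.cos β = 0 := by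
  unfold ebc at h
  have h1 := Real.sin_sq_add_cos_sq α
  have h2 := Real.sin_sq_add_cos_sq β
  have h3 := Real.sin_sq_add_cos_sq (γ + θ)
  have key : (-(Real.sin α * Real.sin β) - Real.cos (γ + θ)) ^ 2
      + (Real.cos α - Real.sin (γ + θ)) ^ 2 + (Real.sin α * Real.cos β) ^ 2 = 0 := by
    linear_combination h1 + h3 - 2 * h + Real.sin α ^ 2 * h2
  refine ⟨?_, ?_, ?_⟩ <;> refine sub_eq_zero.mp (pow_eq_zero_iff two_ne_zero |>.mp ?_) <;>
    nlinarith [sq_nonneg (-(Real.sin α * Real.sin β) - Real.cos (γ + θ)),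
      sq_nonneg (Real.cos α - Real.sin (γ + θ)), sq_nonneg (Real.sin α * Real.cos β)]

/-- If a sum of `N` equispaced unit phasors with phase step `t` vanishes, then `N * t` is at
least a full turn in absolute value. -/
lemma two_pi_le_of_sum_exp_eq_zero {N : ℕ} (hN : 0 < N) {t : ℝ}
    (h : ∑ n ∈ Finset.range N, Complex.exp (Complex.I * ((n * t : ℝ) : ℂ)) = 0) :
    2 * Real.pi ≤ N * |t| := by
  have hN' : (0 : ℝ) < N := by exact_mod_cast hN
  have hpow : ∀ n : ℕ, Complex.exp (Complex.I * ((n * t : ℝ) : ℂ))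
      = Complex.exp (Complex.I * t) ^ n := by
    intro n
    rw [← Complex.exp_nat_mul]
    congr 1
    push_cast
    ring
  have hgeom := geom_sum_mul (Complex.exp (Complex.I * t)) N
  rw [← Finset.sum_congr rfl (fun n _ => hpow n), h, zero_mul] at hgeom
  have h1 : Complex.exp (Complex.I * ((N * t : ℝ) : ℂ)) = 1 := by
    rw [hpow]
    exact (sub_eq_zero.mp hgeom.symm)
  obtain ⟨k, hk⟩ := Complex.exp_eq_one_iff.mp h1
  have hk' : N * t = k * (2 * Real.pi) := by
    have : Complex.I * ((N * t : ℝ) : ℂ) = Complex.I * ((k * (2 * Real.pi) : ℝ) : ℂ) := by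
      rw [hk]
      push_cast
      ring
    exact_mod_cast mul_left_cancel₀ Complex.I_ne_zero this
  have hk0 : k ≠ 0 := by
    rintro rfl
    have ht : t = 0 := by
      rcases mul_eq_zero.mp (show (N : ℝ) * t = 0 by rw [hk']; simp) with h0 | h0
      · exact absurd h0 hN'.ne'
      · exact h0
    subst ht
    simp at h
    omega
  have hkabs : (1 : ℝ) ≤ |(k : ℝ)| := by exact_mod_cast Int.one_le_abs hk0
  calc 2 * Real.pi ≤ |(k : ℝ)| * (2 * Real.pi) :=
        le_mul_of_one_le_left Real.two_pi_pos.le hkabs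
    _ = |N * t| := by rw [hk', abs_mul, abs_of_pos Real.two_pi_pos]
    _ = N * |t| := by rw [abs_mul, abs_of_pos hN']

/-- The phasors with phase step `2π / N` sum to zero. -/
lemma sum_exp_two_pi_div_eq_zero {N : ℕ} (hN : 1 < N) :
    ∑ n ∈ Finset.range N, Complex.exp (Complex.I * ((n * (2 * Real.pi / N) : ℝ) : ℂ)) = 0 := by
  rw [← (Complex.isPrimitiveRoot_exp N (by omega)).geom_sum_eq_zero hN]
  refine Finset.sum_congr rfl fun n _ => ?_
  rw [← Complex.exp_nat_mul]
  congr 1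
  push_cast
  ring

/-- Angles separated from `0` modulo `2π` by at least `arcsin s`, described by sine and cosine. -/
lemma mem_Icc_arcsin_iff {s x : ℝ} (hs0 : 0 < s) (hs1 : s ≤ 1) (hx0 : 0 ≤ x)
    (hx : x < 2 * Real.pi) :
    x ∈ Set.Icc (Real.arcsin s) (2 * Real.pi - Real.arcsin s) ↔
      s ≤ |Real.sin x| ∨ Real.cos x ≤ 0 := by
  have hsin := Real.sin_arcsin (by linarith : -1 ≤ s) hs1
  have ha2 := Real.arcsin_le_pi_div_two s
  have ha0 := Real.arcsin_pos.mpr hs0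
  set a := Real.arcsin s
  have near : ∀ y, 0 ≤ y → y < a → ¬ (s ≤ |Real.sin y| ∨ Real.cos y ≤ 0) := by
    intro y hy0 hya
    have h1 := Real.sin_lt_sin_of_lt_of_le_pi_div_two (by linarith [Real.pi_pos]) ha2 hya
    have h2 := Real.sin_nonneg_of_nonneg_of_le_pi hy0 (by linarith [Real.pi_pos])
    have h3 := Real.cos_pos_of_mem_Ioo ⟨by linarith [Real.pi_pos], hya.trans_le ha2⟩
    rw [abs_of_nonneg h2]
    rintro (h | h) <;> linarith
  have far : ∀ y, a ≤ y → y ≤ Real.pi / 2 → s ≤ |Real.sin y| := by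
    intro y hay hy
    rw [← hsin]
    exact (Real.sin_le_sin_of_le_of_le_pi_div_two (by linarith [Real.pi_pos]) hy hay).trans
      (le_abs_self _)
  have hs' : |Real.sin (2 * Real.pi - x)| = |Real.sin x| := by
    rw [Real.sin_two_pi_sub, abs_neg]
  have hc' : Real.cos (2 * Real.pi - x) = Real.cos x := Real.cos_two_pi_sub x
  constructor
  · rintro ⟨h1, h2⟩
    by_cases hl : x ≤ Real.pi / 2
    · exact Or.inl (far x h1 hl)
    · by_cases hr : 2 * Real.pi - x ≤ Real.pi / 2
      · exact Or.inl (hs' ▸ far _ (by linarith) hr)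
      · exact Or.inr (Real.cos_nonpos_of_pi_div_two_le_of_le (by linarith) (by linarith))
  · intro h
    refine ⟨?_, ?_⟩ <;> by_contra! hlt
    · exact near x hx0 hlt h
    · refine near (2 * Real.pi - x) (by linarith) (by linarith) ?_
      rwa [hs', hc']

/-- Proposition 3: for a directional rotatable ULA with λ ≤ Nd, rotation angles
achieving full element gain at θ₀ together with either steering-vector
orthogonality or zero element gain at θ₁ exist iff the angular separation lies in
[arcsin(λ/(Nd)), 2π − arcsin(λ/(Nd))]. -/
theorem stmt_4 (N : ℕ) (hN : 1 < N) (d lam : ℝ) (hd : 0 < d) (hlam : 0 < lam)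
    (hle : lam ≤ N * d)
    (θ₀ θ₁ : ℝ) (hθ₀ : θ₀ ∈ Set.Ico 0 (2 * Real.pi)) (hθ₁ : θ₁ ∈ Set.Ico 0 (2 * Real.pi)) :
    (∃ α β γ : ℝ, α ∈ Set.Ico 0 (2 * Real.pi) ∧ β ∈ Set.Ico 0 (2 * Real.pi) ∧
      γ ∈ Set.Ico 0 (2 * Real.pi) ∧
      ebc α β γ θ₀ = 1 ∧
      ((∑ n ∈ Finset.range N,
          Complex.exp (Complex.I *
            ((2 * Real.pi / lam * n * d * Real.cos β *
              (Real.cos (γ + θ₁) - Real.cos (γ + θ₀)) : ℝ) : ℂ)) = 0)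
        ∨ ebc α β γ θ₁ ≤ 0))
    ↔ |θ₀ - θ₁| ∈
        Set.Icc (Real.arcsin (lam / (N * d))) (2 * Real.pi - Real.arcsin (lam / (N * d))) := by
  have hN0 : (0 : ℝ) < N := by exact_mod_cast (by omega : 0 < N)
  have hNd : 0 < N * d := mul_pos hN0 hd
  have hs0 : 0 < lam / (N * d) := div_pos hlam hNd
  have hs1 : lam / (N * d) ≤ 1 := (div_le_one hNd).mpr hle
  have habs : |θ₀ - θ₁| < 2 * Real.pi :=
    abs_lt.mpr ⟨by linarith [hθ₀.1, hθ₁.2], by linarith [hθ₀.2, hθ₁.1]⟩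
  have hsinabs : |Real.sin (|θ₀ - θ₁|)| = |Real.sin (θ₁ - θ₀)| := by
    rw [abs_sub_comm]
    rcases abs_choice (θ₁ - θ₀) with h | h <;> rw [h]
    rw [Real.sin_neg, abs_neg]
  rw [mem_Icc_arcsin_iff hs0 hs1 (abs_nonneg _) habs, hsinabs, Real.cos_abs,
    ← Real.cos_neg (θ₀ - θ₁), neg_sub]
  have hadd : ∀ γ, γ + θ₁ = (γ + θ₀) + (θ₁ - θ₀) := fun γ => by ring
  constructor
  · rintro ⟨α, β, γ, -, -, -, h1, h | h⟩
    · left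
      obtain ⟨e1, e2, e3⟩ := ebc_eq_one_imp h1
      have hfull := two_pi_le_of_sum_exp_eq_zero (N := N) (by omega)
        (t := 2 * Real.pi / lam * d * Real.cos β * (Real.cos (γ + θ₁) - Real.cos (γ + θ₀))) (by
          rw [← h]
          refine Finset.sum_congr rfl fun n _ => ?_
          congr 3
          ring)
      have hβ : Real.cos β ≠ 0 := by
        intro h0
        simp only [h0, mul_zero, zero_mul, abs_zero] at hfull
        linarith [Real.pi_pos]
      have hα : Real.sin α = 0 := (mul_eq_zero.mp e3).resolve_right hβ
      have hφ : Real.cos (γ + θ₀) = 0 := by rw [← e1, hα]; ring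
      rw [hadd, Real.cos_add, hφ, zero_mul, sub_zero, zero_sub, abs_mul, abs_mul, abs_neg,
        abs_mul, abs_mul (Real.sin _), abs_of_pos (div_pos Real.two_pi_pos hlam), abs_of_pos hd]
        at hfull
      have hprod : |Real.cos β| * (|Real.sin (γ + θ₀)| * |Real.sin (θ₁ - θ₀)|)
          ≤ |Real.sin (θ₁ - θ₀)| := by
        calc _ ≤ 1 * (1 * |Real.sin (θ₁ - θ₀)|) := by
              gcongr
              · exact Real.abs_cos_le_one β
              · exact Real.abs_sin_le_one _
          _ = _ := by ring
      refine le_trans ?_ hprod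
      rw [div_le_iff₀ hNd]
      have hfull' : 2 * Real.pi * lam ≤ 2 * Real.pi *
          (|Real.cos β| * (|Real.sin (γ + θ₀)| * |Real.sin (θ₁ - θ₀)|) * (N * d)) := by
        calc _ ≤ _ := mul_le_mul_of_nonneg_right hfull hlam.le
          _ = _ := by field_simp
      exact le_of_mul_le_mul_left hfull' Real.two_pi_pos
    · right
      obtain ⟨e1, e2, e3⟩ := ebc_eq_one_imp h1
      convert h using 1
      rw [ebc, e2, neg_mul, e1, ← Real.cos_sub, ← Real.cos_neg]
      congr 1
      ring
  · intro h
    obtain ⟨γ, hγ, hγθ⟩ : ∃ γ ∈ Set.Ico 0 (2 * Real.pi),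
        ∃ k : ℤ, γ + θ₀ = Real.pi / 2 - k * (2 * Real.pi) := by
      refine ⟨toIcoMod Real.two_pi_pos 0 (Real.pi / 2 - θ₀),
        by simpa using toIcoMod_mem_Ico Real.two_pi_pos 0 (Real.pi / 2 - θ₀),
        toIcoDiv Real.two_pi_pos 0 (Real.pi / 2 - θ₀), ?_⟩
      rw [toIcoMod, zsmul_eq_mul]
      ring
    obtain ⟨k, hk⟩ := hγθ
    have hsin : Real.sin (γ + θ₀) = 1 := by
      rw [hk, Real.sin_sub_int_mul_two_pi, Real.sin_pi_div_two]
    have hcos : Real.cos (γ + θ₀) = 0 := by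
      rw [hk, Real.cos_sub_int_mul_two_pi, Real.cos_pi_div_two]
    have hzero : (0 : ℝ) ∈ Set.Ico 0 (2 * Real.pi) := ⟨le_rfl, Real.two_pi_pos⟩
    rcases h with h | h
    · have hS : Real.sin (θ₁ - θ₀) ≠ 0 := fun h0 => by
        rw [h0, abs_zero] at h
        linarith
      have hle1 : |lam / (N * d) / -Real.sin (θ₁ - θ₀)| ≤ 1 := by
        rw [abs_div, abs_neg, abs_of_pos hs0]
        exact (div_le_one (abs_pos.mpr hS)).mpr h
      refine ⟨0, Real.arccos (lam / (N * d) / -Real.sin (θ₁ - θ₀)), γ, hzero,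
        ⟨Real.arccos_nonneg _, (Real.arccos_le_pi _).trans_lt (by linarith [Real.pi_pos])⟩, hγ,
        by simp [ebc, hsin], Or.inl ?_⟩
      rw [Real.cos_arccos (abs_le.mp hle1).1 (abs_le.mp hle1).2,
        ← sum_exp_two_pi_div_eq_zero hN, hadd, Real.cos_add, hcos, hsin]
      refine Finset.sum_congr rfl fun n _ => ?_
      congr 3
      generalize Real.sin (θ₁ - θ₀) = S at hS
      field_simp
      ring
    · refine ⟨0, 0, γ, hzero, hzero, hγ, by simp [ebc, hsin], Or.inr ?_⟩
      rw [ebc, hadd, Real.sin_add (γ + θ₀), hsin, hcos]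
      simpa using h
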